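/- arXiv:2308.15595 — 2 statements merged into one kernel-verified Lean document; each statement's English description precedes it below -/
import Mathlib

section
/- Let q be a prime power, n ≥ 2 an integer, and a, b ∈ F_q^*. Then |N_n(a,b) − (q^{n−1} − 1)/(q − 1)| ≤ (q − 2)·q^{(n−2)/2} + 1/(q − 1), where the inequality is between real numbers and q^{(n−2)/2} denotes the real (n−2)/2-th power of q. -/
section CharacterSums

open Finset

/-- The absolute value of the Gauss sum of a nontrivial multiplicative character and a primitive
additive character of a finite field. -/
theorem norm_gaussSum_eq_sqrt_card {F : Type*} [Field F] [Fintype F] {χ : MulChar F ℂ}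
    (hχ : χ ≠ 1) {ψ : AddChar F ℂ} (hψ : ψ.IsPrimitive) :
    ‖gaussSum χ ψ‖ = √(Fintype.card F) := by
  have h := gaussSum_mul_gaussSum_eq_card hχ hψ
  rw [← star_gaussSum_eq] at h
  have h2 := congrArg norm h
  rw [norm_mul, norm_star, Complex.norm_natCast] at h2
  rw [← h2, Real.sqrt_mul_self (norm_nonneg _)]

theorem MulChar.norm_apply_eq_one {F : Type*} [Field F] [Finite F] (χ : MulChar F ℂ) {b : F}
    (hb : b ≠ 0) : ‖χ b‖ = 1 := by
  have h1 : star (χ b) * χ b = 1 := by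
    rw [MulChar.star_apply', ← MulChar.mul_apply, inv_mul_cancel, MulChar.one_apply (Ne.isUnit hb)]
  have h2 := congrArg norm h1
  rw [norm_mul, norm_star, norm_one] at h2
  nlinarith [norm_nonneg (χ b)]

/-- Orthogonality of the complex multiplicative characters of a finite field. -/
theorem MulChar.sum_inv_apply_mul_apply {F : Type*} [Field F] [Fintype F] [DecidableEq F]
    [Fintype (MulChar F ℂ)] {a : F} (ha : a ≠ 0) (x : F) :
    ∑ χ : MulChar F ℂ, χ a⁻¹ * χ x = if x = a then (Fintype.card F : ℂ) - 1 else 0 := by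
  simp only [← map_mul]
  split_ifs with h
  · subst h
    have hcard := MulChar.card_eq_card_units_of_hasEnoughRootsOfUnity F ℂ
    rw [Nat.card_eq_fintype_card, Nat.card_eq_fintype_card, Fintype.card_units] at hcard
    simp [inv_mul_cancel₀ ha, hcard, Nat.cast_sub Fintype.card_pos]
  · have h1 : a⁻¹ * x ≠ 1 := fun h1 ↦ h ((inv_mul_eq_one₀ ha).mp h1).symm
    obtain ⟨χ, hχ⟩ := MulChar.exists_apply_ne_one_of_hasEnoughRootsOfUnity F ℂ h1
    refine eq_zero_of_mul_eq_self_left hχ ?_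
    simp only [Finset.mul_sum, ← MulChar.mul_apply]
    exact Fintype.sum_bijective _ (Group.mulLeft_bijective χ) _ _ fun χ' ↦ rfl

variable {K L : Type*} [Field K] [Field L] [Fintype L] [Algebra K L]

variable (L) in
/-- The lift of a multiplicative character along the norm of an extension of finite fields. -/
noncomputable def MulChar.compNorm (χ : MulChar K ℂ) : MulChar L ℂ :=
  MulChar.ofUnitHom (χ.toUnitHom.comp (Units.map (Algebra.norm K)))

theorem MulChar.compNorm_apply (χ : MulChar K ℂ) (z : L) :
    χ.compNorm L z = χ (Algebra.norm K z) := by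
  by_cases hz : z = 0
  · subst hz
    simp [Algebra.norm_zero]
  · lift z to Lˣ using Ne.isUnit hz
    rw [MulChar.compNorm, MulChar.ofUnitHom_coe]
    simp

open Classical in
variable (L) in
/-- The sum of `χ (N z)` over the elements `z` of trace `b`. -/
noncomputable def traceFiberSum (χ : MulChar K ℂ) (b : K) : ℂ :=
  ∑ z : L with Algebra.trace K L z = b, χ (Algebra.norm K z)

theorem traceFiberSum_eq_pow_apply_mul (χ : MulChar K ℂ) {b : K} (hb : b ≠ 0) :
    traceFiberSum L χ b = (χ ^ Module.finrank K L) b * traceFiberSum L χ 1 := by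
  classical
  have hb' : algebraMap K L b ≠ 0 := by simpa using hb
  rw [traceFiberSum, traceFiberSum, mul_sum]
  symm
  refine sum_bijective (algebraMap K L b * ·) (mulLeft_bijective₀ _ hb') ?_ ?_
  · intro z
    simp [← Algebra.smul_def, hb]
  · intro z _
    rw [map_mul, Algebra.norm_algebraMap, map_mul, map_pow,
      MulChar.pow_apply' _ Module.finrank_pos.ne']

theorem MulChar.compNorm_ne_one {χ : MulChar K ℂ} (hχ : χ ≠ 1) : χ.compNorm L ≠ 1 := by
  obtain ⟨a, ha⟩ := MulChar.ne_one_iff.mp hχ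
  obtain ⟨z, hz⟩ := FiniteField.unitsMap_norm_surjective K L a
  refine MulChar.ne_one_iff.mpr ⟨z, ?_⟩
  rw [MulChar.compNorm_apply]
  simpa [← hz] using ha

variable [Fintype K]

/-- The lift of a primitive additive character along the trace is primitive. -/
theorem AddChar.IsPrimitive.compTrace {ψ : AddChar K ℂ} (hψ : ψ.IsPrimitive) :
    (ψ.compAddMonoidHom (Algebra.trace K L).toAddMonoidHom).IsPrimitive := by
  have h1 : ψ ≠ 1 := by
    have := hψ one_ne_zero
    rwa [AddChar.mulShift_one] at this
  apply AddChar.IsPrimitive.of_ne_one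
  obtain ⟨b, hb⟩ := AddChar.ne_one_iff.mp h1
  obtain ⟨z, hz⟩ := Algebra.trace_surjective K L b
  exact AddChar.ne_one_iff.mpr ⟨z, by simpa [hz] using hb⟩

theorem sum_mul_traceFiberSum (χ : MulChar K ℂ) (f : K → ℂ) :
    ∑ b, f b * traceFiberSum L χ b = ∑ z : L, f (Algebra.trace K L z) * χ (Algebra.norm K z) := by
  classical
  rw [← Finset.sum_fiberwise univ (Algebra.trace K L)]
  refine sum_congr rfl fun b _ ↦ ?_
  rw [traceFiberSum, mul_sum]
  refine sum_congr (by congr) fun z hz ↦ ?_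
  rw [(mem_filter.mp hz).2]

theorem norm_traceFiberSum_le {χ : MulChar K ℂ} (hχ : χ ≠ 1) {b : K} (hb : b ≠ 0) :
    ‖traceFiberSum L χ b‖ ≤ √((Fintype.card K : ℝ) ^ (Module.finrank K L - 1)) := by
  classical
  set d := Module.finrank K L
  set q := Fintype.card K with hq
  have hdpos : 0 < d := Module.finrank_pos
  have hq1 : 1 < q := Fintype.one_lt_card
  set S := traceFiberSum L χ with hS
  have hscale (f : K → ℂ) : ∑ c, f c * S c = (∑ c, (χ ^ d) c * f c) * S 1 + f 0 * S 0 := by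
    rw [← add_sum_erase _ _ (mem_univ (0 : K)),
      ← add_sum_erase univ (fun c ↦ (χ ^ d) c * f c) (mem_univ (0 : K)), MulChar.map_zero,
      zero_mul, zero_add, sum_mul, add_comm]
    congr 1
    refine sum_congr rfl fun c hc ↦ ?_
    rw [hS, traceFiberSum_eq_pow_apply_mul χ (ne_of_mem_erase hc)]
    ring
  obtain ⟨ψ, hψ⟩ : ∃ ψ : AddChar K ℂ, ψ.IsPrimitive :=
    ⟨_, AddChar.FiniteField.primitiveChar_to_Complex_isPrimitive K⟩
  have hψ1 : ψ ≠ 1 := by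
    have := hψ one_ne_zero
    rwa [AddChar.mulShift_one] at this
  have hgauss : gaussSum (χ.compNorm L) (ψ.compAddMonoidHom (Algebra.trace K L).toAddMonoidHom)
      = gaussSum (χ ^ d) ψ * S 1 + S 0 := by
    have h := hscale ψ
    rw [hS, sum_mul_traceFiberSum, AddChar.map_zero_eq_one, one_mul] at h
    rw [gaussSum, gaussSum, ← h]
    refine sum_congr rfl fun z _ ↦ ?_
    rw [MulChar.compNorm_apply, mul_comm]
    rfl
  have hzero : 0 = (∑ c, (χ ^ d) c) * S 1 + S 0 := by
    have h := hscale 1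
    rw [hS, sum_mul_traceFiberSum] at h
    simp only [Pi.one_apply, one_mul, mul_one, ← MulChar.compNorm_apply] at h
    rwa [MulChar.sum_eq_zero_of_ne_one (MulChar.compNorm_ne_one hχ)] at h
  have hcomb : gaussSum (χ.compNorm L)
      (ψ.compAddMonoidHom (Algebra.trace K L).toAddMonoidHom)
      = (gaussSum (χ ^ d) ψ - ∑ c, (χ ^ d) c) * S 1 := by
    linear_combination hgauss - hzero
  have hnorm := congrArg norm hcomb
  rw [norm_gaussSum_eq_sqrt_card (MulChar.compNorm_ne_one hχ) hψ.compTrace, norm_mul,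
    Module.card_eq_pow_finrank (K := K) (V := L)] at hnorm
  have hlow : √(q : ℝ) ≤ ‖gaussSum (χ ^ d) ψ - ∑ c, (χ ^ d) c‖ := by
    by_cases h1 : χ ^ d = 1
    · rw [h1, gaussSum_one_left hψ1, MulChar.sum_one_eq_card_units, Fintype.card_units, ← hq,
        Nat.cast_sub hq1.le, Nat.cast_one, show (-1 - ((q : ℂ) - 1)) = -(q : ℂ) by ring,
        norm_neg, Complex.norm_natCast]
      have : (1 : ℝ) ≤ q := by exact_mod_cast hq1.le
      exact Real.sqrt_le_self_iff.mpr (Or.inr this)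
    · rw [MulChar.sum_eq_zero_of_ne_one h1, sub_zero, norm_gaussSum_eq_sqrt_card h1 hψ]
  have hqpos : 0 < √(q : ℝ) := Real.sqrt_pos.mpr (by exact_mod_cast hq1.le)
  rw [hS, traceFiberSum_eq_pow_apply_mul χ hb, norm_mul, MulChar.norm_apply_eq_one _ hb, one_mul]
  refine le_of_mul_le_mul_left ?_ hqpos
  calc √(q : ℝ) * ‖S 1‖ ≤ _ := mul_le_mul_of_nonneg_right hlow (norm_nonneg _)
    _ = √(((q ^ d : ℕ) : ℝ)) := hnorm.symm
    _ = _ := by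
      rw [← Real.sqrt_mul (by positivity), ← pow_succ', Nat.sub_add_cancel hdpos, Nat.cast_pow]

theorem traceFiberSum_one {b : K} (hb : b ≠ 0) :
    traceFiberSum L 1 b = (Fintype.card K : ℂ) ^ (Module.finrank K L - 1) := by
  classical
  have hq0 : (Fintype.card K : ℂ) ≠ 0 := by simp
  have hfib (c : K) : #{z : L | Algebra.trace K L z = c} = #{z : L | Algebra.trace K L z = b} :=
    AddMonoidHom.card_fiber_eq_of_mem_range (Algebra.trace K L).toAddMonoidHom
      (Algebra.trace_surjective K L c) (Algebra.trace_surjective K L b)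
  have hcard := card_eq_sum_card_fiberwise (s := (univ : Finset L)) (t := (univ : Finset K))
    (f := Algebra.trace K L) (by simp)
  simp only [hfib, sum_const, smul_eq_mul, card_univ] at hcard
  rw [Module.card_eq_pow_finrank (K := K) (V := L),
    ← Nat.sub_add_cancel (Module.finrank_pos (R := K) (M := L)), pow_succ'] at hcard
  have h := Nat.eq_of_mul_eq_mul_left Fintype.card_pos hcard
  rw [traceFiberSum, sum_congr rfl (g := fun _ ↦ (1 : ℂ)), sum_const, nsmul_one]
  · rw [← Nat.cast_pow, h]
  · intro z hz
    refine MulChar.one_apply (Ne.isUnit ?_)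
    rw [Algebra.norm_ne_zero_iff]
    rintro rfl
    exact hb (by simpa using (mem_filter.mp hz).2.symm)

/-- The number of elements of prescribed norm and trace, up to the contribution of the nontrivial
multiplicative characters. -/
theorem abs_card_norm_trace_sub_le {a b : K} (ha : a ≠ 0) (hb : b ≠ 0) :
    |((Fintype.card K : ℝ) - 1) *
        Nat.card {z : L // Algebra.norm K z = a ∧ Algebra.trace K L z = b}
        - (Fintype.card K : ℝ) ^ (Module.finrank K L - 1)|
      ≤ ((Fintype.card K : ℝ) - 2) * √((Fintype.card K : ℝ) ^ (Module.finrank K L - 1)) := by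
  classical
  let _ : Fintype (MulChar K ℂ) := Fintype.ofFinite _
  set q := Fintype.card K
  have hq1 : 1 < q := Fintype.one_lt_card
  have hN : ((q : ℂ) - 1) * Nat.card {z : L // Algebra.norm K z = a ∧ Algebra.trace K L z = b}
      = ∑ χ : MulChar K ℂ, χ a⁻¹ * traceFiberSum L χ b := by
    simp only [traceFiberSum, mul_sum]
    rw [sum_comm]
    simp only [MulChar.sum_inv_apply_mul_apply ha]
    rw [← sum_filter, filter_filter, sum_const, nsmul_eq_mul, mul_comm,
      Nat.card_eq_fintype_card, Fintype.card_subtype]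
    simp only [and_comm]
    rfl
  rw [← add_sum_erase _ _ (mem_univ (1 : MulChar K ℂ)), traceFiberSum_one hb,
    MulChar.one_apply (Ne.isUnit (inv_ne_zero ha)), one_mul] at hN
  have hcard : (#((univ : Finset (MulChar K ℂ)).erase 1) : ℝ) = (q : ℝ) - 2 := by
    have h := MulChar.card_eq_card_units_of_hasEnoughRootsOfUnity K ℂ
    rw [Nat.card_eq_fintype_card, Nat.card_eq_fintype_card, Fintype.card_units] at h
    rw [card_erase_of_mem (mem_univ _), card_univ, h, Nat.sub_sub, Nat.cast_sub hq1]
    norm_num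
  have hbound : ‖∑ χ ∈ (univ : Finset (MulChar K ℂ)).erase 1, χ a⁻¹ * traceFiberSum L χ b‖
      ≤ ((q : ℝ) - 2) * √((q : ℝ) ^ (Module.finrank K L - 1)) := by
    rw [← hcard, ← nsmul_eq_mul]
    refine (norm_sum_le _ _).trans (sum_le_card_nsmul _ _ _ fun χ hχ ↦ ?_)
    rw [norm_mul, MulChar.norm_apply_eq_one _ (inv_ne_zero ha), one_mul]
    exact norm_traceFiberSum_le (ne_of_mem_erase hχ) hb
  rw [← Real.norm_eq_abs, ← Complex.norm_real]
  push_cast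
  rwa [hN, add_sub_cancel_left]

end CharacterSums


/-- `|N_n(a,b) - (q^(n-1)-1)/(q-1)| ≤ (q-2)·q^((n-2)/2) + 1/(q-1)`. -/
theorem stmt1 (q n : ℕ) (hq : IsPrimePow q) (hn : 2 ≤ n)
    (Fq Fqn : Type) [Field Fq] [Field Fqn] [Fintype Fq] [Fintype Fqn]
    [Algebra Fq Fqn]
    (hcard : Fintype.card Fq = q) (hcardn : Fintype.card Fqn = q ^ n)
    (a b : Fq) (ha : a ≠ 0) (hb : b ≠ 0) :
    |(Nat.card {z : Fqn // Algebra.norm Fq z = a ∧ Algebra.trace Fq Fqn z = b} : ℝ)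
        - ((q : ℝ) ^ (n - 1) - 1) / ((q : ℝ) - 1)|
      ≤ ((q : ℝ) - 2) * (q : ℝ) ^ (((n : ℝ) - 2) / 2) + 1 / ((q : ℝ) - 1) := by
  have hq2 : 2 ≤ q := hcard ▸ Fintype.one_lt_card
  have hd : Module.finrank Fq Fqn = n := by
    have h := Module.card_eq_pow_finrank (K := Fq) (V := Fqn)
    rw [hcard, hcardn] at h
    exact (Nat.pow_right_injective hq2 h).symm
  have key := abs_card_norm_trace_sub_le (L := Fqn) ha hb
  rw [hd, hcard] at key
  set N : ℝ :=
    (Nat.card {z : Fqn // Algebra.norm Fq z = a ∧ Algebra.trace Fq Fqn z = b} : ℝ)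
  have hq2' : (2 : ℝ) ≤ q := by exact_mod_cast hq2
  have hpos : (0 : ℝ) < q - 1 := by linarith
  have hsqrt : √((q : ℝ) ^ (n - 1)) = √(q : ℝ) * (q : ℝ) ^ (((n : ℝ) - 2) / 2) := by
    rw [Real.sqrt_eq_rpow, Real.sqrt_eq_rpow, ← Real.rpow_natCast, ← Real.rpow_mul (by linarith),
      ← Real.rpow_add (by linarith), Nat.cast_sub (by omega)]
    congr 1
    push_cast
    ring
  have hroot : ((q : ℝ) - 2) * √(q : ℝ) ≤ ((q : ℝ) - 2) * (q - 1) := by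
    obtain rfl | h3 : q = 2 ∨ 3 ≤ q := by omega
    · norm_num
    · have h3' : (3 : ℝ) ≤ q := by exact_mod_cast h3
      refine mul_le_mul_of_nonneg_left (Real.sqrt_le_iff.mpr ⟨hpos.le, ?_⟩) (by linarith)
      nlinarith
  set P : ℝ := (q : ℝ) ^ (((n : ℝ) - 2) / 2)
  have hP : 0 ≤ P := Real.rpow_nonneg (by linarith) _
  have hmain : |((q : ℝ) - 1) * N - (q : ℝ) ^ (n - 1)| ≤ ((q : ℝ) - 2) * (q - 1) * P := by
    refine key.trans ?_
    rw [hsqrt, ← mul_assoc]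
    exact mul_le_mul_of_nonneg_right hroot hP
  have hsplit : N - ((q : ℝ) ^ (n - 1) - 1) / ((q : ℝ) - 1)
      = (((q : ℝ) - 1) * N - (q : ℝ) ^ (n - 1)) / (q - 1) + 1 / (q - 1) := by
    field_simp
    ring
  rw [hsplit]
  refine (abs_add_le _ _).trans (add_le_add ?_ (abs_of_pos (by positivity)).le)
  rw [abs_div, abs_of_pos hpos, div_le_iff₀ hpos]
  linarith
end

section
/- Let q be a prime power, n ≥ 2 an integer, a, b ∈ F_q^*, u := a/b^n ∈ F_q^*, and d := gcd(q − 1, n). Let #Y_u(F_q) denote the number of tuples (x_1, …, x_{n−1}) ∈ (F_q^*)^{n−1} satisfying x_1 + ⋯ + x_{n−1} + u/(x_1⋯x_{n−1}) = 1. Then |#Y_u(F_q) − ((q − 1)^{n−1} − (−1)^{n−1})/q| ≤ (1 + (q − 2)·q^{(n−1)/2} − q^{(n−2)/2}·(q^{1/2} − 1)·(d − 1))/(q − 1), the inequality being between real numbers. -/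
/-- The Jacobi-type sum `∑ χ(x₁) ⋯ χ(xₙ)` over all tuples with `x₁ + ⋯ + xₙ = t`. -/
noncomputable def diagonalJacobiSum {F : Type*} [Field F] [Fintype F] (χ : MulChar F ℂ)
    (n : ℕ) (t : F) : ℂ :=
  open Classical in ∑ x : Fin n → F, if ∑ i, x i = t then ∏ i, χ (x i) else 0

section

variable {F : Type*} [Field F] [Fintype F]

lemma sum_mul_diagonalJacobiSum (χ : MulChar F ℂ) (n : ℕ) (f : F → ℂ) :
    ∑ t, f t * diagonalJacobiSum χ n t = ∑ x : Fin n → F, f (∑ i, x i) * ∏ i, χ (x i) := by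
  classical
  simp only [diagonalJacobiSum, Finset.mul_sum]
  rw [Finset.sum_comm]
  refine Finset.sum_congr rfl fun x _ ↦ ?_
  simp

lemma sum_diagonalJacobiSum (χ : MulChar F ℂ) (n : ℕ) :
    ∑ t, diagonalJacobiSum χ n t = (∑ a, χ a) ^ n := by
  have h := sum_mul_diagonalJacobiSum χ n 1
  simp only [Pi.one_apply, one_mul] at h
  rw [h, Fintype.sum_pow]

lemma sum_addChar_mul_diagonalJacobiSum (χ : MulChar F ℂ) (ψ : AddChar F ℂ) (n : ℕ) :
    ∑ t, ψ t * diagonalJacobiSum χ n t = gaussSum χ ψ ^ n := by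
  rw [sum_mul_diagonalJacobiSum, gaussSum, Fintype.sum_pow]
  refine Finset.sum_congr rfl fun x _ ↦ ?_
  rw [Finset.prod_mul_distrib, mul_comm]
  congr 1
  exact map_prod ψ.toMonoidHom (fun i ↦ Multiplicative.ofAdd (x i)) Finset.univ

lemma diagonalJacobiSum_of_ne_zero (χ : MulChar F ℂ) (n : ℕ) {t : F} (ht : t ≠ 0) :
    diagonalJacobiSum χ n t = χ t ^ n * diagonalJacobiSum χ n 1 := by
  classical
  simp only [diagonalJacobiSum, Finset.mul_sum]
  refine (Fintype.sum_equiv (Equiv.piCongrRight fun _ ↦ Equiv.mulLeft₀ t ht) _ _ fun x ↦ ?_).symm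
  have h : (∑ i, t * x i = t) ↔ ∑ i, x i = 1 := by
    rw [← Finset.mul_sum]
    exact mul_eq_left₀ ht
  simp [h, Finset.prod_mul_distrib]

lemma sum_mul_diagonalJacobiSum_eq (χ : MulChar F ℂ) {n : ℕ} (hn : n ≠ 0) (f : F → ℂ) :
    ∑ t, f t * diagonalJacobiSum χ n t = f 0 * diagonalJacobiSum χ n 0 +
      (∑ t, (χ ^ n) t * f t) * diagonalJacobiSum χ n 1 := by
  classical
  rw [← Finset.add_sum_erase _ _ (Finset.mem_univ (0 : F)),
    ← Finset.add_sum_erase _ (fun t ↦ (χ ^ n) t * f t) (Finset.mem_univ (0 : F)),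
    MulChar.map_zero, zero_mul, zero_add, Finset.sum_mul]
  congr 1
  refine Finset.sum_congr rfl fun t ht ↦ ?_
  rw [diagonalJacobiSum_of_ne_zero χ n (Finset.ne_of_mem_erase ht), MulChar.pow_apply' χ hn]
  ring

lemma diagonalJacobiSum_zero_add (χ : MulChar F ℂ) {n : ℕ} (hn : n ≠ 0) :
    diagonalJacobiSum χ n 0 + (∑ t, (χ ^ n) t) * diagonalJacobiSum χ n 1 = (∑ a, χ a) ^ n := by
  simpa [sum_diagonalJacobiSum] using (sum_mul_diagonalJacobiSum_eq χ hn 1).symm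

lemma diagonalJacobiSum_zero_add_gaussSum_mul (χ : MulChar F ℂ) (ψ : AddChar F ℂ) {n : ℕ}
    (hn : n ≠ 0) :
    diagonalJacobiSum χ n 0 + gaussSum (χ ^ n) ψ * diagonalJacobiSum χ n 1 =
      gaussSum χ ψ ^ n := by
  simpa [sum_addChar_mul_diagonalJacobiSum, gaussSum] using
    (sum_mul_diagonalJacobiSum_eq χ hn ψ).symm

lemma exists_addChar_ne_one : ∃ ψ : AddChar F ℂ, ψ ≠ 1 := by
  obtain ⟨ψ, hψ⟩ := AddChar.exists_apply_ne_zero.mpr (one_ne_zero : (1 : F) ≠ 0)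
  exact ⟨ψ, AddChar.ne_one_iff.mpr ⟨1, hψ⟩⟩

lemma norm_gaussSum {χ : MulChar F ℂ} (hχ : χ ≠ 1) {ψ : AddChar F ℂ} (hψ : ψ ≠ 1) :
    ‖gaussSum χ ψ‖ = (Fintype.card F : ℝ) ^ ((1 : ℝ) / 2) := by
  have h := gaussSum_mul_gaussSum_eq_card hχ (AddChar.IsPrimitive.of_ne_one hψ)
  rw [← star_gaussSum_eq, ← starRingEnd_apply, Complex.mul_conj] at h
  have h' : Complex.normSq (gaussSum χ ψ) = Fintype.card F := by exact_mod_cast h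
  rw [← Real.sqrt_eq_rpow, ← h', Complex.normSq_eq_norm_sq, Real.sqrt_sq (norm_nonneg _)]

lemma norm_mulChar_apply (χ : MulChar F ℂ) {a : F} (ha : a ≠ 0) : ‖χ a‖ = 1 := by
  classical
  refine Complex.norm_eq_one_of_pow_eq_one (n := Fintype.card Fˣ) ?_ Fintype.card_ne_zero
  rw [← MulChar.pow_apply' χ Fintype.card_ne_zero, χ.pow_card_eq_one,
    MulChar.one_apply ha.isUnit]

lemma sum_one_mulChar : ∑ t, (1 : MulChar F ℂ) t = (Fintype.card F : ℂ) - 1 := by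
  classical
  rw [MulChar.sum_one_eq_card_units, Fintype.card_units, Nat.cast_sub Fintype.card_pos]
  simp

lemma norm_diagonalJacobiSum_of_pow_ne_one {χ : MulChar F ℂ} {n : ℕ} (hn : n ≠ 0)
    (hχ : χ ≠ 1) (hχn : χ ^ n ≠ 1) :
    ‖diagonalJacobiSum χ n 1‖ = (Fintype.card F : ℝ) ^ (((n : ℝ) - 1) / 2) := by
  obtain ⟨ψ, hψ⟩ := exists_addChar_ne_one (F := F)
  have hq : (0 : ℝ) < Fintype.card F := by exact_mod_cast Fintype.card_pos
  have h0 := diagonalJacobiSum_zero_add χ hn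
  rw [MulChar.sum_eq_zero_of_ne_one hχ, MulChar.sum_eq_zero_of_ne_one hχn, zero_pow hn, zero_mul,
    add_zero] at h0
  have h1 := congrArg norm (diagonalJacobiSum_zero_add_gaussSum_mul χ ψ hn)
  rw [h0, zero_add, norm_mul, norm_pow, norm_gaussSum hχ hψ, norm_gaussSum hχn hψ,
    ← Real.rpow_mul_natCast hq.le] at h1
  rw [← mul_right_inj' (Real.rpow_pos_of_pos hq (1 / 2)).ne', h1, ← Real.rpow_add hq]
  ring_nf

lemma norm_diagonalJacobiSum_of_pow_eq_one {χ : MulChar F ℂ} {n : ℕ} (hn : n ≠ 0)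
    (hχ : χ ≠ 1) (hχn : χ ^ n = 1) :
    ‖diagonalJacobiSum χ n 1‖ = (Fintype.card F : ℝ) ^ (((n : ℝ) - 2) / 2) := by
  obtain ⟨ψ, hψ⟩ := exists_addChar_ne_one (F := F)
  have hq : (0 : ℝ) < Fintype.card F := by exact_mod_cast Fintype.card_pos
  have h0 := diagonalJacobiSum_zero_add χ hn
  rw [MulChar.sum_eq_zero_of_ne_one hχ, hχn, zero_pow hn, sum_one_mulChar] at h0
  have h1 := diagonalJacobiSum_zero_add_gaussSum_mul χ ψ hn
  rw [hχn, gaussSum_one_left hψ] at h1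
  have h2 := congrArg norm (show (Fintype.card F : ℂ) * diagonalJacobiSum χ n 1 =
    -gaussSum χ ψ ^ n by linear_combination h0 - h1)
  rw [norm_mul, norm_neg, norm_pow, norm_gaussSum hχ hψ, Complex.norm_natCast,
    ← Real.rpow_mul_natCast hq.le] at h2
  rw [← mul_right_inj' hq.ne', h2, ← Real.rpow_one_add' hq.le]
  · ring_nf
  · have : (n : ℝ) ≠ 0 := by exact_mod_cast hn
    intro h
    exact this (by linarith)

lemma card_mul_diagonalJacobiSum_one {n : ℕ} (hn : n ≠ 0) :
    (Fintype.card F : ℂ) * diagonalJacobiSum (1 : MulChar F ℂ) n 1 =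
      ((Fintype.card F : ℂ) - 1) ^ n - (-1) ^ n := by
  obtain ⟨ψ, hψ⟩ := exists_addChar_ne_one (F := F)
  have h0 := diagonalJacobiSum_zero_add (1 : MulChar F ℂ) hn
  have h1 := diagonalJacobiSum_zero_add_gaussSum_mul (1 : MulChar F ℂ) ψ hn
  rw [one_pow, sum_one_mulChar] at h0
  rw [one_pow, gaussSum_one_left hψ] at h1
  linear_combination h0 - h1

lemma card_mulChar [Fintype (MulChar F ℂ)] :
    Fintype.card (MulChar F ℂ) = Fintype.card F - 1 := by
  classical
  rw [← Nat.card_eq_fintype_card, MulChar.card_eq_card_units_of_hasEnoughRootsOfUnity,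
    Nat.card_eq_fintype_card, Fintype.card_units]

lemma sum_mulChar_apply [Fintype (MulChar F ℂ)] [DecidableEq F] (a : F) :
    ∑ χ : MulChar F ℂ, χ a = if a = 1 then (Fintype.card F : ℂ) - 1 else 0 := by
  split_ifs with h
  · simp [h, card_mulChar, Nat.cast_sub (Fintype.card_pos (α := F))]
  · obtain ⟨χ, hχ⟩ := MulChar.exists_apply_ne_one_of_hasEnoughRootsOfUnity F ℂ h
    refine eq_zero_of_mul_eq_self_left hχ ?_
    rw [Finset.mul_sum]
    exact Fintype.sum_bijective _ (Group.mulLeft_bijective χ) _ _ fun φ ↦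
      (MulChar.mul_apply χ φ a).symm

lemma card_mulChar_pow_eq_one [Fintype (MulChar F ℂ)] [DecidableEq (MulChar F ℂ)] (n : ℕ) :
    (Finset.univ.filter fun χ : MulChar F ℂ ↦ χ ^ n = 1).card = (Fintype.card F - 1).gcd n := by
  classical
  have e := (MulChar.mulEquiv_units F ℂ).some
  have : IsCyclic (MulChar F ℂ) := isCyclic_of_surjective e.symm e.symm.surjective
  rw [← Fintype.card_units, ← Nat.card_eq_fintype_card,
    ← MulChar.card_eq_card_units_of_hasEnoughRootsOfUnity F ℂ,
    ← IsCyclic.card_powMonoidHom_ker, ← Fintype.card_subtype,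
    ← Nat.card_eq_fintype_card]
  rfl

/-- The number of solutions of `x₁ + ⋯ + xₙ = 1`, `x₁ ⋯ xₙ = u`, expanded in characters. -/
lemma card_sum_eq_one_prod_eq [Fintype (MulChar F ℂ)] (n : ℕ) {u : F} (hu : u ≠ 0) :
    ((Fintype.card F : ℂ) - 1) * Nat.card {x : Fin n → F // ∑ i, x i = 1 ∧ ∏ i, x i = u} =
      ∑ χ : MulChar F ℂ, χ u⁻¹ * diagonalJacobiSum χ n 1 := by
  classical
  simp only [diagonalJacobiSum, Finset.mul_sum]
  rw [Finset.sum_comm, Nat.card_eq_fintype_card, Fintype.card_subtype, Finset.card_filter]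
  push_cast
  rw [Finset.mul_sum]
  refine Finset.sum_congr rfl fun x _ ↦ ?_
  by_cases hx : ∑ i, x i = 1
  · have h := sum_mulChar_apply (u⁻¹ * ∏ i, x i)
    rw [inv_mul_eq_one₀ hu] at h
    simp only [map_mul, map_prod] at h
    simp [hx, h, eq_comm]
  · simp [hx]

end

/-- Adjoining the last coordinate `u / ∏ xᵢ` to a solution of the toric equation. -/
lemma card_toric_eq {F : Type*} [Field F] (m : ℕ) {u : F} (hu : u ≠ 0) :
    Nat.card {x : Fin m → F // (∀ i, x i ≠ 0) ∧ (∑ i, x i) + u / (∏ i, x i) = 1} =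
      Nat.card {x : Fin (m + 1) → F // ∑ i, x i = 1 ∧ ∏ i, x i = u} := by
  have key (x : Fin (m + 1) → F) (hx : ∏ i, x i = u) :
      (∀ i : Fin m, x i.castSucc ≠ 0) ∧ u / ∏ i : Fin m, x i.castSucc = x (Fin.last m) := by
    have h0 : ∀ i, x i ≠ 0 := fun i ↦ by
      rw [← hx, Finset.prod_ne_zero_iff] at hu
      exact hu i (Finset.mem_univ i)
    refine ⟨fun i ↦ h0 _, ?_⟩
    rw [div_eq_iff (Finset.prod_ne_zero_iff.mpr fun i _ ↦ h0 _), ← hx, Fin.prod_univ_castSucc,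
      mul_comm]
  refine Nat.card_congr
    { toFun := fun x ↦ ⟨Fin.snoc x.1 (u / ∏ i, x.1 i), ?_, ?_⟩
      invFun := fun x ↦ ⟨fun i ↦ x.1 i.castSucc, (key x.1 x.2.2).1, ?_⟩
      left_inv := fun x ↦ ?_
      right_inv := fun x ↦ ?_ }
  · simpa [Fin.sum_univ_castSucc] using x.2.2
  · have := Finset.prod_ne_zero_iff.mpr fun i (_ : i ∈ Finset.univ) ↦ x.2.1 i
    simp [Fin.prod_univ_castSucc, mul_div_cancel₀ _ this]
  · rw [(key x.1 x.2.2).2, ← Fin.sum_univ_castSucc, x.2.1]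
  · simp
  · ext i
    refine Fin.lastCases ?_ (fun j ↦ ?_) i
    · simpa using (key x.1 x.2.2).2
    · simp

lemma sum_norm_diagonalJacobiSum {F : Type*} [Field F] [Fintype F] [Fintype (MulChar F ℂ)]
    [DecidableEq (MulChar F ℂ)] {n : ℕ} (hn : n ≠ 0) :
    ∑ χ ∈ Finset.univ.erase (1 : MulChar F ℂ), ‖diagonalJacobiSum χ n 1‖ =
      ((Fintype.card F : ℝ) - 1 - ((Fintype.card F - 1).gcd n : ℕ)) *
          (Fintype.card F : ℝ) ^ (((n : ℝ) - 1) / 2) +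
        (((Fintype.card F - 1).gcd n : ℕ) - 1 : ℝ) *
          (Fintype.card F : ℝ) ^ (((n : ℝ) - 2) / 2) := by
  have h (χ) (hχ : χ ∈ Finset.univ.erase (1 : MulChar F ℂ)) : ‖diagonalJacobiSum χ n 1‖ =
      (Fintype.card F : ℝ) ^ (((n : ℝ) - 1) / 2) + if χ ^ n = 1 then
        (Fintype.card F : ℝ) ^ (((n : ℝ) - 2) / 2) - (Fintype.card F : ℝ) ^ (((n : ℝ) - 1) / 2)
      else 0 := by
    have hχ' := Finset.ne_of_mem_erase hχ
    split_ifs with hχn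
    · rw [norm_diagonalJacobiSum_of_pow_eq_one hn hχ' hχn]
      ring
    · rw [norm_diagonalJacobiSum_of_pow_ne_one hn hχ' hχn, add_zero]
  have hc : (Fintype.card (MulChar F ℂ) : ℝ) = Fintype.card F - 1 := by
    rw [card_mulChar, Nat.cast_sub Fintype.card_pos, Nat.cast_one]
  rw [Finset.sum_congr rfl h, Finset.sum_erase_eq_sub (Finset.mem_univ _), Finset.sum_add_distrib,
    ← Finset.sum_filter, Finset.sum_const, Finset.sum_const, card_mulChar_pow_eq_one,
    Finset.card_univ, nsmul_eq_mul, nsmul_eq_mul, hc, one_pow, if_pos rfl]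
  ring

/-- improved bound on the number of `F_q`-points of the toric
Calabi–Yau hypersurface `x_1 + ⋯ + x_{n-1} + u/(x_1⋯x_{n-1}) = 1`, `u = a/b^n`. -/
theorem stmt5 (q n : ℕ) (hq : IsPrimePow q) (hn : 2 ≤ n)
    (Fq : Type) [Field Fq] [Fintype Fq] (hcard : Fintype.card Fq = q)
    (a b : Fq) (ha : a ≠ 0) (hb : b ≠ 0)
    (u : Fq) (hu : u = a / b ^ n)
    (d : ℕ) (hd : d = Nat.gcd (q - 1) n)
    (Y : ℕ)
    (hY : Y = Nat.card {x : Fin (n - 1) → Fq //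
        (∀ i, x i ≠ 0) ∧ (∑ i, x i) + u / (∏ i, x i) = 1}) :
    |(Y : ℝ) - (((q : ℝ) - 1) ^ (n - 1) - (-1 : ℝ) ^ (n - 1)) / (q : ℝ)|
      ≤ (1 + ((q : ℝ) - 2) * (q : ℝ) ^ (((n : ℝ) - 1) / 2)
          - (q : ℝ) ^ (((n : ℝ) - 2) / 2) * ((q : ℝ) ^ ((1 : ℝ) / 2) - 1) * ((d : ℝ) - 1))
        / ((q : ℝ) - 1) := by
  classical
  have : Fintype (MulChar Fq ℂ) := Fintype.ofFinite _
  have hu0 : u ≠ 0 := hu ▸ div_ne_zero ha (pow_ne_zero n hb)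
  have hq1 : (1 : ℝ) < q := by exact_mod_cast hq.one_lt
  have hqC : (q : ℂ) ≠ 0 := by exact_mod_cast hq.pos.ne'
  obtain ⟨m, rfl⟩ : ∃ m, n = m + 1 := ⟨n - 1, by omega⟩
  change Y = Nat.card {x : Fin m → Fq // (∀ i, x i ≠ 0) ∧ (∑ i, x i) + u / (∏ i, x i) = 1} at hY
  rw [Nat.add_sub_cancel]
  set M : ℝ := (((q : ℝ) - 1) ^ m - (-1 : ℝ) ^ m) / q with hM
  have hN := card_sum_eq_one_prod_eq (m + 1) hu0
  rw [← card_toric_eq m hu0, ← hY, hcard, ← Finset.add_sum_erase _ _ (Finset.mem_univ 1),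
    MulChar.one_apply (inv_ne_zero hu0).isUnit, one_mul] at hN
  have hJ := card_mul_diagonalJacobiSum_one (F := Fq) m.succ_ne_zero
  rw [hcard, Nat.succ_eq_add_one] at hJ
  have hJM : diagonalJacobiSum (1 : MulChar Fq ℂ) (m + 1) 1 =
      ((q : ℂ) - 1) * (M : ℂ) + (-1) ^ m := by
    rw [← mul_right_inj' hqC, hJ, hM]
    push_cast
    field_simp
    ring
  have hdiff : (((q - 1) * (Y - M) : ℝ) : ℂ) = (-1) ^ m +
      ∑ χ ∈ Finset.univ.erase (1 : MulChar Fq ℂ), χ u⁻¹ * diagonalJacobiSum χ (m + 1) 1 := by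
    push_cast
    linear_combination hN + hJM
  have hbound : (q - 1) * |Y - M| ≤
      1 + ∑ χ ∈ Finset.univ.erase (1 : MulChar Fq ℂ), ‖diagonalJacobiSum χ (m + 1) 1‖ := by
    rw [← abs_of_pos (sub_pos.mpr hq1), ← abs_mul, ← Real.norm_eq_abs, ← Complex.norm_real, hdiff]
    refine (norm_add_le _ _).trans (add_le_add (by simp) (norm_sum_le_of_le _ fun χ _ ↦ ?_))
    rw [norm_mul]
    exact mul_le_of_le_one_left (norm_nonneg _) (norm_mulChar_apply χ (inv_ne_zero hu0)).le
  rw [sum_norm_diagonalJacobiSum m.succ_ne_zero, hcard, ← hd] at hbound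
  rw [le_div_iff₀ (sub_pos.mpr hq1), mul_comm]
  refine hbound.trans_eq ?_
  have hpow : (q : ℝ) ^ ((((m + 1 : ℕ) : ℝ) - 1) / 2) =
      (q : ℝ) ^ ((((m + 1 : ℕ) : ℝ) - 2) / 2) * (q : ℝ) ^ ((1 : ℝ) / 2) := by
    rw [← Real.rpow_add (by linarith)]
    ring_nf
  rw [hpow]
  ring
end
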